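/- For any composition r of n, the coefficient of Ξ^r in the expansion of (Ξ^r)² in the basis {Ξ^s : s ⊨ n} of the descent algebra equals ∏_i m_i(r)!, where m_i(r) is the number of parts of r equal to i. -/

import Mathlib

open scoped Classical

/-- The Solomon descent element `Ξ^q`. -/
noncomputable def Xi (R : Type*) [CommRing R] {n : ℕ} (q : Composition n) :
    MonoidAlgebra R (Equiv.Perm (Fin n)) :=
  ∑ σ ∈ Finset.univ.filter (fun σ : Equiv.Perm (Fin n) =>
      ∀ i j : Fin n, (j : ℕ) = (i : ℕ) + 1 → σ j < σ i →
        ∃ t ∈ Finset.range (q.length + 1), (j : ℕ) = q.sizeUpTo t),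
    MonoidAlgebra.single σ (1 : R)

/-- The set `N^s_{r,q}` of matrices with row sums `r`, column sums `q`, and
row-reading (after deleting zeros) equal to `s`. -/
def NSet {n : ℕ} (s r q : Composition n) : Set (Fin r.length → Fin q.length → ℕ) :=
  {A | (∀ i, ∑ j, A i j = r.blocksFun i) ∧ (∀ j, ∑ i, A i j = q.blocksFun j) ∧
    ((List.ofFn (fun i => List.ofFn (fun j => A i j))).flatten.filter
      (fun x => decide (x ≠ 0))) = s.blocks}

open Finset in
/-- For a monotone `g`, the points below level `t` form an initial segment whose length is the
total size of the fibres below `t`. -/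
theorem lt_sum_card_fiber_iff {n N : ℕ} {g : Fin n → Fin N} (hg : Monotone g) (t : ℕ) (p : Fin n) :
    (p : ℕ) < ∑ k with (k : Fin N).val < t, #{x | g x = k} ↔ (g p : ℕ) < t := by
  have hsum : ∑ k with (k : Fin N).val < t, #{x | g x = k} = #{x | (g x : ℕ) < t} := by
    rw [card_eq_sum_card_fiberwise (f := g) (t := univ.filter fun k : Fin N => k.val < t)
      (fun x hx => by simpa using hx)]
    refine sum_congr rfl fun k hk => congrArg card ?_
    ext x
    simp only [mem_filter, mem_univ, true_and] at hk ⊢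
    exact ⟨fun h => ⟨h ▸ hk, h⟩, fun h => h.2⟩
  rw [hsum]
  cases t with
  | zero => simp
  | succ u =>
    have := Tuple.lt_card_le_iff_apply_le_of_monotone (j := p) (f := fun x => (g x : ℕ)) (a := u)
      (fun x y h => hg h)
    simpa [Nat.lt_succ_iff] using this

open Finset in
theorem Monotone.eq_of_card_fiber_eq {n N : ℕ} {g g' : Fin n → Fin N} (hg : Monotone g)
    (hg' : Monotone g') (h : ∀ k, #{x | g x = k} = #{x | g' x = k}) : g = g' := by
  have key : ∀ p t, (g p : ℕ) < t ↔ (g' p : ℕ) < t := fun p t => by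
    rw [← lt_sum_card_fiber_iff hg, ← lt_sum_card_fiber_iff hg']
    simp only [h]
  funext p
  have h1 := (key p (g p + 1)).1 (by omega)
  have h2 := (key p (g' p + 1)).2 (by omega)
  exact Fin.ext (by omega)

open Finset in
theorem exists_monotone_card_fiber {n N : ℕ} (m : Fin N → ℕ) (hm : ∑ k, m k = n) :
    ∃ g : Fin n → Fin N, Monotone g ∧ ∀ k, #{x | g x = k} = m k := by
  have e : Fin n ≃ Σ k, Fin (m k) := Fintype.equivOfCardEq (by simp [hm])
  let f : Fin n → Fin N := fun x => (e x).1
  refine ⟨f ∘ Tuple.sort f, Tuple.monotone_sort f, fun k => ?_⟩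
  have h : Fintype.card {x // (f ∘ Tuple.sort f) x = k} = Fintype.card (Fin (m k)) :=
    Fintype.card_congr <|
      (((Tuple.sort f).trans e).subtypeEquiv (q := fun y => y.1 = k) fun x => Iff.rfl).trans
        (Equiv.sigmaSubtype k)
  simpa [Fintype.card_subtype] using h

theorem Composition.monotone_index {n : ℕ} (c : Composition n) : Monotone c.index := by
  intro p q h
  by_contra! hlt
  have h1 := c.lt_sizeUpTo_index_succ q
  have h2 := c.sizeUpTo_index_le p
  have h3 := c.monotone_sizeUpTo (show ((c.index q).succ : ℕ) ≤ c.index p from by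
    simpa [Nat.succ_le_iff] using hlt)
  have h4 : (p : ℕ) ≤ q := h
  omega

open Finset in
theorem Composition.card_index_eq {n : ℕ} (c : Composition n) (i : Fin c.length) :
    #{p | c.index p = i} = c.blocksFun i := by
  have : ({p | c.index p = i} : Finset (Fin n)) = univ.map (c.embedding i).toEmbedding := by
    ext p
    have := c.mem_range_embedding_iff' (j := p) (i := i)
    simp only [Set.mem_range] at this
    simp [this, @eq_comm _ i]
  simp [this]

theorem List.exists_eq_sum_take_filter (l : List ℕ) (x : ℕ) :
    (∃ t, x = ((l.filter fun y => decide (y ≠ 0)).take t).sum) ↔ ∃ t, x = (l.take t).sum := by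
  induction l generalizing x with
  | nil => simp
  | cons a l ih =>
    have step : ∀ (b : ℕ) (l' : List ℕ), (∃ t, x = ((b :: l').take t).sum) ↔
        x = 0 ∨ ∃ y, x = b + y ∧ ∃ t, y = (l'.take t).sum := by
      intro b l'
      constructor
      · rintro ⟨t, ht⟩
        cases t with
        | zero => exact Or.inl (by simpa using ht)
        | succ t => exact Or.inr ⟨_, by simpa using ht, t, rfl⟩
      · rintro (h | ⟨y, hy, t, ht⟩)
        · exact ⟨0, by simpa using h⟩
        · exact ⟨t + 1, by simp [hy, ht]⟩
    rw [step]
    by_cases ha : a = 0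
    · subst ha
      simp only [← ih, zero_add, ne_eq, not_true_eq_false, decide_false, Bool.false_eq_true,
        not_false_eq_true, List.filter_cons_of_neg]
      constructor
      · exact fun h => Or.inr ⟨x, rfl, h⟩
      · rintro (h | ⟨y, rfl, h⟩)
        · exact ⟨0, by simpa using h⟩
        · exact h
    · rw [List.filter_cons_of_pos (by simpa using ha), step]
      simp only [ih]

open Finset in
/-- The proper partial sums of a composition `s` are the jumps of any monotone map whose fibre
sizes, zeros deleted, are the blocks of `s`. -/
theorem Composition.exists_eq_sizeUpTo_iff {n N : ℕ} (s : Composition n) {g : Fin n → Fin N}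
    (hg : Monotone g)
    (hs : ((List.ofFn fun k => #{x | g x = k}).filter fun y => decide (y ≠ 0)) = s.blocks)
    {p q : Fin n} (hpq : (q : ℕ) = p + 1) :
    (∃ t ∈ range (s.length + 1), (q : ℕ) = s.sizeUpTo t) ↔ g p ≠ g q := by
  have h1 : (∃ t ∈ range (s.length + 1), (q : ℕ) = s.sizeUpTo t) ↔
      ∃ t, (q : ℕ) = (s.blocks.take t).sum := by
    constructor
    · rintro ⟨t, -, h⟩
      exact ⟨t, h⟩
    · rintro ⟨t, h⟩
      by_cases ht : t < s.length + 1
      · exact ⟨t, by simpa using ht, h⟩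
      · refine absurd h ?_
        rw [List.take_of_length_le (by rw [s.blocks_length]; omega), s.blocks_sum]
        exact q.2.ne
  rw [h1, ← hs, List.exists_eq_sum_take_filter]
  simp only [List.sum_take_ofFn]
  have hle : (g p : ℕ) ≤ g q := hg (show (p : ℕ) ≤ q by omega)
  constructor
  · rintro ⟨t, ht⟩ h
    have hp := (lt_sum_card_fiber_iff hg t p).1 (by omega)
    have hq := (lt_sum_card_fiber_iff hg t q).2 (h ▸ hp)
    omega
  · intro h
    have hlt : (g p : ℕ) < g q := lt_of_le_of_ne hle fun h' => h (Fin.ext h')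
    have hp := (lt_sum_card_fiber_iff hg (g q) p).2 hlt
    have hq := mt (lt_sum_card_fiber_iff hg (g q) q).1 (lt_irrefl _)
    exact ⟨g q, by omega⟩

/-- The permutations occurring in `Ξ^q`. -/
noncomputable def Composition.descentPerms {n : ℕ} (q : Composition n) :
    Finset (Equiv.Perm (Fin n)) :=
  Finset.univ.filter fun σ : Equiv.Perm (Fin n) =>
    ∀ i j : Fin n, (j : ℕ) = (i : ℕ) + 1 → σ j < σ i →
      ∃ t ∈ Finset.range (q.length + 1), (j : ℕ) = q.sizeUpTo t

open Finset in
theorem Composition.mem_descentPerms {n N : ℕ} (s : Composition n) {g : Fin n → Fin N}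
    (hg : Monotone g)
    (hs : ((List.ofFn fun k => #{x | g x = k}).filter fun y => decide (y ≠ 0)) = s.blocks)
    (σ : Equiv.Perm (Fin n)) :
    σ ∈ s.descentPerms ↔ ∀ p q, p < q → g p = g q → σ p < σ q := by
  have h : σ ∈ s.descentPerms ↔
      ∀ p q : Fin n, (q : ℕ) = p + 1 → g p = g q → σ p < σ q := by
    simp only [descentPerms, mem_filter, mem_univ, true_and]
    refine forall_congr' fun p => forall_congr' fun q => forall_congr' fun hpq => ?_
    rw [s.exists_eq_sizeUpTo_iff hg hs hpq, ne_eq, imp_not_comm, not_lt]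
    refine imp_congr_right fun _ => ⟨fun h => lt_of_le_of_ne h fun h' => ?_, le_of_lt⟩
    have := σ.injective h'
    omega
  rw [h]
  refine ⟨fun H p q hpq => ?_, fun H p q hpq => H p q (Fin.lt_def.2 (by omega))⟩
  obtain ⟨d, hd⟩ : ∃ d, (q : ℕ) = p + 1 + d := ⟨q - (p + 1), by omega⟩
  clear hpq
  induction d generalizing q with
  | zero => exact H p q hd
  | succ d ih =>
    intro heq
    let q' : Fin n := ⟨p + 1 + d, by omega⟩
    have hp : g p ≤ g q' := hg (Fin.le_def.2 (by simp only [q']; omega))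
    have hq : g q' ≤ g q := hg (Fin.le_def.2 (by simp only [q']; omega))
    exact (ih q' rfl (le_antisymm hp (heq ▸ hq))).trans
      (H q' q (by simp only [q']; omega) (le_antisymm hq (heq ▸ hp)))

theorem Composition.mem_descentPerms_iff_index {n : ℕ} (s : Composition n)
    (σ : Equiv.Perm (Fin n)) :
    σ ∈ s.descentPerms ↔ ∀ p q, p < q → s.index p = s.index q → σ p < σ q := by
  refine s.mem_descentPerms s.monotone_index ?_ σ
  simp only [s.card_index_eq, s.ofFn_blocksFun]
  exact List.filter_eq_self.2 fun a ha => by simpa using (s.blocks_pos ha).ne'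

/-- The matrices of natural numbers with row sums `q` and column sums `r`. -/
def marginSet {n : ℕ} (q r : Composition n) : Set (Fin q.length → Fin r.length → ℕ) :=
  {A | (∀ i, ∑ j, A i j = q.blocksFun i) ∧ ∀ j, ∑ i, A i j = r.blocksFun j}

instance {n : ℕ} (q r : Composition n) : Finite (marginSet q r) := by
  refine (Set.finite_Iic fun (_ : Fin q.length) (_ : Fin r.length) => n).subset ?_
  intro A hA i j
  calc A i j ≤ ∑ j, A i j := Finset.single_le_sum (fun _ _ => Nat.zero_le _) (Finset.mem_univ j)
    _ = q.blocksFun i := hA.1 i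
    _ ≤ n := q.blocksFun_le i

noncomputable instance {n : ℕ} (q r : Composition n) : Fintype (marginSet q r) :=
  Fintype.ofFinite _

theorem List.ofFn_flatten_eq_finProdFinEquiv {a b : ℕ} (A : Fin a → Fin b → ℕ) :
    (List.ofFn fun i => List.ofFn fun j => A i j).flatten =
      List.ofFn fun k => A (finProdFinEquiv.symm k).1 (finProdFinEquiv.symm k).2 := by
  rw [List.ofFn_mul]
  have : ∀ (i : Fin a) (j : Fin b) (h : (i : ℕ) * b + j < a * b),
      finProdFinEquiv.symm (⟨i * b + j, h⟩ : Fin (a * b)) = (i, j) := fun i j h => by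
    rw [Equiv.symm_apply_eq]
    ext
    simp [mul_comm, add_comm]
  simp only [this]

theorem sum_finProdFinEquiv_symm {a b : ℕ} (A : Fin a → Fin b → ℕ) :
    ∑ k, A (finProdFinEquiv.symm k).1 (finProdFinEquiv.symm k).2 = ∑ i, ∑ j, A i j := by
  rw [Equiv.sum_comp finProdFinEquiv.symm fun x => A x.1 x.2, Fintype.sum_prod_type]

/-- The composition obtained by reading a matrix row by row and deleting the zeros. -/
def readingComposition {n : ℕ} {q r : Composition n} (A : marginSet q r) : Composition n where
  blocks := (List.ofFn fun i => List.ofFn fun j => A.1 i j).flatten.filter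
    fun x => decide (x ≠ 0)
  blocks_pos := fun h => by
    have := (List.mem_filter.1 h).2
    simp only [ne_eq, decide_not, Bool.not_eq_true', decide_eq_false_iff_not] at this
    omega
  blocks_sum := by
    have h : ∀ l : List ℕ, (l.filter fun x => decide (x ≠ 0)).sum = l.sum := fun l => by
      induction l with
      | nil => rfl
      | cons a l ih => by_cases ha : a = 0 <;> simp_all
    rw [h, List.ofFn_flatten_eq_finProdFinEquiv, List.sum_ofFn, sum_finProdFinEquiv_symm,
      Finset.sum_congr rfl fun i _ => A.2.1 i, q.sum_blocksFun]

theorem sum_card_NSet_smul {R M : Type*} [Semiring R] [AddCommMonoid M] [Module R M] {n : ℕ}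
    (q r : Composition n) (f : Composition n → M) :
    ∑ s, (Nat.card (NSet s q r) : R) • f s = ∑ A : marginSet q r, f (readingComposition A) := by
  rw [← Finset.sum_fiberwise Finset.univ readingComposition]
  refine Finset.sum_congr rfl fun s _ => ?_
  rw [Finset.sum_congr rfl fun A hA => congrArg f (Finset.mem_filter.1 hA).2, Finset.sum_const,
    Nat.cast_smul_eq_nsmul, ← Fintype.card_subtype, ← Nat.card_eq_fintype_card]
  congr 1
  refine Nat.card_congr ⟨fun A => ⟨⟨A.1, A.2.1, A.2.2.1⟩, Composition.ext A.2.2.2⟩,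
    fun A => ⟨A.1.1, A.1.2.1, A.1.2.2, congrArg Composition.blocks A.2⟩,
    fun _ => rfl, fun _ => rfl⟩

/-- The row-major index of the cell of the matrix in which a point with row index `q.index p`
and column index `c p` is placed. -/
def cell {n : ℕ} (q r : Composition n) (c : Fin n → Fin r.length) (p : Fin n) :
    Fin (q.length * r.length) :=
  finProdFinEquiv (q.index p, c p)

theorem finProdFinEquiv_lt_of_fst_lt {a b : ℕ} {i i' : Fin a} (h : i < i') (j j' : Fin b) :
    finProdFinEquiv (i, j) < finProdFinEquiv (i', j') := by
  rw [Fin.lt_def]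
  simp only [finProdFinEquiv_apply_val]
  have := Nat.mul_le_mul_left b (Nat.succ_le_of_lt (Fin.lt_def.1 h))
  rw [Nat.mul_succ] at this
  omega

theorem finProdFinEquiv_le_iff {a b : ℕ} (i : Fin a) (j j' : Fin b) :
    finProdFinEquiv (i, j) ≤ finProdFinEquiv (i, j') ↔ j ≤ j' := by
  rw [Fin.le_def, Fin.le_def]
  simp

theorem monotone_cell_iff {n : ℕ} (q r : Composition n) (c : Fin n → Fin r.length) :
    Monotone (cell q r c) ↔ ∀ p p', p ≤ p' → q.index p = q.index p' → c p ≤ c p' := by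
  constructor
  · intro h p p' hp hq
    have := h hp
    rwa [cell, cell, hq, finProdFinEquiv_le_iff] at this
  · intro h p p' hp
    rcases (q.monotone_index hp).lt_or_eq with hlt | heq
    · exact (finProdFinEquiv_lt_of_fst_lt hlt _ _).le
    · rw [cell, cell, heq, finProdFinEquiv_le_iff]
      exact h p p' hp heq

theorem cell_eq_cell_iff {n : ℕ} {q r : Composition n} {c c' : Fin n → Fin r.length}
    {p p' : Fin n} : cell q r c p = cell q r c' p' ↔ q.index p = q.index p' ∧ c p = c' p' := by
  simp [cell]

open Finset in
theorem card_cell_eq {n : ℕ} (q r : Composition n) (c : Fin n → Fin r.length)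
    (k : Fin (q.length * r.length)) :
    #{p | cell q r c p = k} =
      #{p | q.index p = (finProdFinEquiv.symm k).1 ∧ c p = (finProdFinEquiv.symm k).2} := by
  refine congrArg card (filter_congr fun p _ => ?_)
  rw [cell, ← Equiv.eq_symm_apply, Prod.ext_iff]

theorem Composition.card_index_perm_eq {n : ℕ} (r : Composition n) (τ : Equiv.Perm (Fin n))
    (j : Fin r.length) :
    (Finset.univ.filter fun p => r.index (τ p) = j).card = r.blocksFun j := by
  rw [← r.card_index_eq]
  exact Finset.card_equiv τ (by simp)

open Finset in
/-- The matrix counting how a permutation distributes the blocks of `q` over those of `r`. -/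
def overlap {n : ℕ} (q r : Composition n) (τ : Equiv.Perm (Fin n)) : marginSet q r :=
  ⟨fun i j => #{p | q.index p = i ∧ r.index (τ p) = j}, by
    constructor
    · intro i
      rw [← q.card_index_eq, card_eq_sum_card_fiberwise (f := fun p => r.index (τ p)) (t := univ)
        (by simp)]
      simp [filter_filter]
    · intro j
      rw [← r.card_index_perm_eq τ, card_eq_sum_card_fiberwise (f := q.index) (t := univ)
        (by simp)]
      simp [filter_filter, and_comm]⟩

theorem mem_descentPerms_readingComposition {n : ℕ} {q r : Composition n} (A : marginSet q r)
    {c : Fin n → Fin r.length} (hc : Monotone (cell q r c))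
    (hA : ∀ i j, (Finset.univ.filter fun p => q.index p = i ∧ c p = j).card = A.1 i j)
    (π : Equiv.Perm (Fin n)) :
    π ∈ (readingComposition A).descentPerms ↔
      ∀ p p', p < p' → q.index p = q.index p' → c p = c p' → π p < π p' := by
  rw [Composition.mem_descentPerms _ hc]
  · simp only [cell_eq_cell_iff, and_imp]
  · simp only [card_cell_eq, hA, readingComposition, List.ofFn_flatten_eq_finProdFinEquiv]

theorem Composition.lt_iff_of_mem_descentPerms {n : ℕ} {r : Composition n}
    {σ : Equiv.Perm (Fin n)} (hσ : σ ∈ r.descentPerms) {p p' : Fin n}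
    (h : r.index p = r.index p') : σ p < σ p' ↔ p < p' := by
  rw [mem_descentPerms_iff_index] at hσ
  refine ⟨fun hlt => ?_, fun hlt => hσ p p' hlt h⟩
  by_contra! hle
  rcases hle.lt_or_eq with h' | rfl
  · exact lt_asymm hlt (hσ p' p h' h.symm)
  · exact lt_irrefl _ hlt

theorem monotone_cell_of_mem_descentPerms {n : ℕ} {q : Composition n} (r : Composition n)
    {τ : Equiv.Perm (Fin n)} (hτ : τ ∈ q.descentPerms) :
    Monotone (cell q r fun p => r.index (τ p)) := by
  rw [monotone_cell_iff]
  intro p p' hp hq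
  refine r.monotone_index ?_
  rcases hp.lt_or_eq with h | rfl
  · exact ((Composition.lt_iff_of_mem_descentPerms hτ hq).2 h).le
  · exact le_rfl

theorem mul_mem_descentPerms_overlap {n : ℕ} {q r : Composition n} {σ τ : Equiv.Perm (Fin n)}
    (hσ : σ ∈ r.descentPerms) (hτ : τ ∈ q.descentPerms) :
    σ * τ ∈ (readingComposition (overlap q r τ)).descentPerms := by
  rw [mem_descentPerms_readingComposition (overlap q r τ)
    (monotone_cell_of_mem_descentPerms r hτ) fun i j => rfl]
  intro p p' hp hq hr
  exact (Composition.lt_iff_of_mem_descentPerms hσ hr).2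
    ((Composition.lt_iff_of_mem_descentPerms hτ hq).2 hp)

theorem Composition.eq_sort_of_mem_descentPerms {n : ℕ} {r : Composition n}
    {σ : Equiv.Perm (Fin n)} (hσ : σ ∈ r.descentPerms) :
    σ = Tuple.sort fun x => r.index (σ.symm x) := by
  rw [Tuple.eq_sort_iff]
  refine ⟨fun p p' h => by simpa using r.monotone_index h, fun p p' h h' => ?_⟩
  rw [mem_descentPerms_iff_index] at hσ
  exact hσ p p' h (by simpa using h')

theorem eq_of_overlap_eq {n : ℕ} {q r : Composition n} {σ σ' τ τ' : Equiv.Perm (Fin n)}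
    (hσ : σ ∈ r.descentPerms) (hσ' : σ' ∈ r.descentPerms)
    (hτ : τ ∈ q.descentPerms) (hτ' : τ' ∈ q.descentPerms)
    (h : overlap q r τ = overlap q r τ') (hmul : σ * τ = σ' * τ') : σ = σ' ∧ τ = τ' := by
  have hcell := (monotone_cell_of_mem_descentPerms r hτ).eq_of_card_fiber_eq
    (monotone_cell_of_mem_descentPerms r hτ') fun k => by
      rw [card_cell_eq, card_cell_eq]
      exact congrFun (congrFun (congrArg Subtype.val h) _) _
  have hindex : ∀ p, r.index (τ p) = r.index (τ' p) := fun p =>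
    (cell_eq_cell_iff.1 (congrFun hcell p)).2
  have hw : (fun x => r.index (σ.symm x)) = fun x => r.index (σ'.symm x) := by
    funext x
    have h1 : σ.symm x = τ ((σ * τ).symm x) := by simp [Equiv.Perm.mul_def]
    have h2 : σ'.symm x = τ' ((σ * τ).symm x) := by rw [hmul]; simp [Equiv.Perm.mul_def]
    rw [h1, h2, hindex]
  have hs : σ = σ' := by
    rw [Composition.eq_sort_of_mem_descentPerms hσ, hw,
      ← Composition.eq_sort_of_mem_descentPerms hσ']
  exact ⟨hs, by simpa [hs] using hmul⟩

open Finset in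
theorem exists_monotone_cell {n : ℕ} {q r : Composition n} (A : marginSet q r) :
    ∃ c : Fin n → Fin r.length, Monotone (cell q r c) ∧
      ∀ i j, #{p | q.index p = i ∧ c p = j} = A.1 i j := by
  obtain ⟨g, hg, hgA⟩ := exists_monotone_card_fiber
    (fun k => A.1 (finProdFinEquiv.symm k).1 (finProdFinEquiv.symm k).2) (by
      rw [sum_finProdFinEquiv_symm, sum_congr rfl fun i _ => A.2.1 i, q.sum_blocksFun])
  have hfib : ∀ i j, #{p | (finProdFinEquiv.symm (g p)).1 = i ∧ (finProdFinEquiv.symm (g p)).2 = j}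
      = A.1 i j := fun i j => by
    have := hgA (finProdFinEquiv (i, j))
    simp only [Equiv.symm_apply_apply] at this
    rw [← this]
    refine congrArg card (filter_congr fun p _ => ?_)
    rw [← Equiv.symm_apply_eq, Prod.ext_iff]
  have hrow : (fun p => (finProdFinEquiv.symm (g p)).1) = q.index := by
    refine Monotone.eq_of_card_fiber_eq (fun p p' hp => ?_) q.monotone_index fun i => ?_
    · by_contra! hlt
      have := finProdFinEquiv_lt_of_fst_lt hlt (finProdFinEquiv.symm (g p')).2
        (finProdFinEquiv.symm (g p)).2
      rw [Prod.mk.eta, Prod.mk.eta, Equiv.apply_symm_apply, Equiv.apply_symm_apply] at this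
      exact absurd (hg hp) (not_le.2 this)
    · rw [q.card_index_eq, ← A.2.1 i, card_eq_sum_card_fiberwise
        (f := fun p => (finProdFinEquiv.symm (g p)).2) (t := univ) (by simp)]
      refine sum_congr rfl fun j _ => ?_
      rw [← hfib, filter_filter]
  refine ⟨fun p => (finProdFinEquiv.symm (g p)).2, ?_, fun i j => ?_⟩
  · convert hg using 1
    funext p
    rw [cell, ← hrow, Prod.mk.eta, Equiv.apply_symm_apply]
  · rw [← hfib, ← hrow]

open Finset in
theorem exists_factorization {n : ℕ} {q r : Composition n} (A : marginSet q r)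
    {π : Equiv.Perm (Fin n)} (hπ : π ∈ (readingComposition A).descentPerms) :
    ∃ σ ∈ r.descentPerms, ∃ τ ∈ q.descentPerms, overlap q r τ = A ∧ σ * τ = π := by
  obtain ⟨c, hc, hcA⟩ := exists_monotone_cell A
  rw [mem_descentPerms_readingComposition A hc hcA] at hπ
  let w : Fin n → Fin r.length := fun x => c (π.symm x)
  let σ := Tuple.sort w
  obtain ⟨hmono, hstable⟩ := Tuple.eq_sort_iff.1 (rfl : σ = Tuple.sort w)
  have hcol : ∀ j, #{p | c p = j} = r.blocksFun j := fun j => by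
    rw [← A.2.2 j, card_eq_sum_card_fiberwise (f := q.index) (t := univ) (by simp)]
    refine sum_congr rfl fun i _ => ?_
    rw [← hcA, filter_filter]
    simp only [and_comm]
  have hw : w ∘ σ = r.index := by
    refine hmono.eq_of_card_fiber_eq r.monotone_index fun j => ?_
    rw [r.card_index_eq, ← hcol]
    exact card_equiv (σ.trans π.symm) (by simp [w])
  have hσ : σ ∈ r.descentPerms := by
    rw [Composition.mem_descentPerms_iff_index, ← hw]
    exact fun p p' h h' => hstable p p' h h'
  have hτc : ∀ p, r.index ((σ⁻¹ * π) p) = c p := fun p => by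
    rw [← hw]
    simp [w]
  refine ⟨σ, hσ, σ⁻¹ * π, ?_, ?_, by simp⟩
  · rw [Composition.mem_descentPerms_iff_index]
    intro p p' hp hq
    rcases ((monotone_cell_iff q r c).1 hc p p' hp.le hq).lt_or_eq with h | h
    · rw [← hτc, ← hτc] at h
      exact r.monotone_index.reflect_lt h
    · have := hπ p p' hp hq h
      rw [← hτc, ← hτc] at h
      rw [← Composition.lt_iff_of_mem_descentPerms hσ h]
      simpa using this
  · refine Subtype.ext (funext fun i => funext fun j => ?_)
    simp only [overlap, hτc, hcA]

/-- The Solomon product rule for the elements `Ξ^r`. -/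
theorem Xi_mul_Xi (R : Type*) [CommRing R] {n : ℕ} (r q : Composition n) :
    Xi R r * Xi R q = ∑ s, (Nat.card (NSet s q r) : R) • Xi R s := by
  have hXi : ∀ s : Composition n, Xi R s = ∑ σ ∈ s.descentPerms, MonoidAlgebra.single σ (1 : R) :=
    fun s => rfl
  rw [sum_card_NSet_smul]
  simp only [hXi, Finset.sum_mul_sum, MonoidAlgebra.single_mul_single, mul_one]
  rw [← Finset.sum_product', Finset.sum_sigma']
  refine Finset.sum_nbij (fun x => ⟨overlap q r x.2, x.1 * x.2⟩) ?_ ?_ ?_ fun _ _ => rfl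
  · rintro ⟨σ, τ⟩ h
    rw [Finset.mem_product] at h
    exact Finset.mem_sigma.2 ⟨Finset.mem_univ _, mul_mem_descentPerms_overlap h.1 h.2⟩
  · rintro ⟨σ, τ⟩ h ⟨σ', τ'⟩ h' heq
    rw [Finset.mem_coe, Finset.mem_product] at h h'
    simp only [Sigma.mk.injEq, heq_eq_eq] at heq
    obtain ⟨h1, h2⟩ := eq_of_overlap_eq h.1 h'.1 h.2 h'.2 heq.1 heq.2
    exact Prod.ext h1 h2
  · rintro ⟨A, π⟩ h
    obtain ⟨σ, hσ, τ, hτ, rfl, rfl⟩ := exists_factorization A (Finset.mem_sigma.1 h).2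
    exact ⟨(σ, τ), Finset.mem_coe.2 (Finset.mem_product.2 ⟨hσ, hτ⟩), rfl⟩

theorem List.filter_ne_zero_ofFn_ite {m : ℕ} (j₀ : Fin m) {a : ℕ} (ha : a ≠ 0) :
    ((List.ofFn fun j => if j = j₀ then a else 0).filter fun x => decide (x ≠ 0)) = [a] := by
  rw [List.ofFn_eq_map, List.filter_map]
  have : (List.finRange m).filter
      ((fun x => decide (x ≠ 0)) ∘ fun j => if j = j₀ then a else 0) = [j₀] := by
    have h : ((fun x => decide (x ≠ 0)) ∘ fun j => if j = j₀ then a else 0) =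
        fun j => decide (j = j₀) := by
      funext j
      by_cases hj : j = j₀ <;> simp [hj, ha]
    rw [h]
    have hc : (List.finRange m).count j₀ = 1 :=
      List.count_eq_one_of_mem (List.nodup_finRange m) (List.mem_finRange j₀)
    have := List.filter_eq (l := List.finRange m) j₀
    simpa [hc] using this
  rw [this]
  simp

theorem List.length_filter_ofFn {m : ℕ} (f : Fin m → ℕ) :
    ((List.ofFn f).filter fun x => decide (x ≠ 0)).length =
      (Finset.univ.filter fun j => f j ≠ 0).card := by
  rw [List.ofFn_eq_map, List.filter_map, List.length_map]
  rfl

/-- The monomial matrix with entry `r i` in position `(i, ρ i)`. -/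
def monomialMatrix {n : ℕ} (r : Composition n) (ρ : Equiv.Perm (Fin r.length)) :
    Fin r.length → Fin r.length → ℕ :=
  fun i j => if j = ρ i then r.blocksFun i else 0

theorem monomialMatrix_mem_NSet {n : ℕ} (r : Composition n) {ρ : Equiv.Perm (Fin r.length)}
    (hρ : r.blocksFun ∘ ρ = r.blocksFun) : monomialMatrix r ρ ∈ NSet r r r := by
  refine ⟨fun i => by simp [monomialMatrix], fun j => ?_, ?_⟩
  · have h : ∀ i, monomialMatrix r ρ i j = if i = ρ.symm j then r.blocksFun i else 0 := fun i => by
      simp only [monomialMatrix, Equiv.eq_symm_apply, @eq_comm _ j]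
    simp only [h, Finset.sum_ite_eq', Finset.mem_univ, if_true]
    simpa using (congrFun hρ (ρ.symm j)).symm
  · rw [List.filter_flatten, List.map_ofFn]
    have h : (List.filter (fun x => decide (x ≠ 0)) ∘
        fun i => List.ofFn fun j => monomialMatrix r ρ i j) = fun i => [r.blocksFun i] := by
      funext i
      exact List.filter_ne_zero_ofFn_ite (ρ i) (Nat.one_le_iff_ne_zero.1 (r.one_le_blocksFun i))
    rw [h]
    have h' : (List.ofFn fun i => [r.blocksFun i]) = r.blocks.map fun x => [x] := by
      rw [← r.ofFn_blocksFun, List.map_ofFn]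
      rfl
    rw [h', ← List.flatMap_def, List.flatMap_singleton']

theorem exists_eq_monomialMatrix {n : ℕ} (r : Composition n)
    {A : Fin r.length → Fin r.length → ℕ} (hA : A ∈ NSet r r r) :
    ∃ ρ : Equiv.Perm (Fin r.length), r.blocksFun ∘ ρ = r.blocksFun ∧ monomialMatrix r ρ = A := by
  obtain ⟨hrow, hcol, hread⟩ := hA
  let d : Fin r.length → ℕ := fun i => (Finset.univ.filter fun j => A i j ≠ 0).card
  have hsum : ∑ i, d i = r.length := by
    have := congrArg List.length hread
    rw [List.filter_flatten, List.map_ofFn, List.length_flatten, List.map_ofFn, List.sum_ofFn,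
      r.blocks_length] at this
    exact (Finset.sum_congr rfl fun i _ => (List.length_filter_ofFn _).symm).trans this
  have hpos : ∀ i, 1 ≤ d i := fun i => by
    rw [Nat.one_le_iff_ne_zero, Finset.card_ne_zero]
    by_contra! h
    rw [Finset.filter_eq_empty_iff] at h
    have h0 : ∑ j, A i j = 0 := Finset.sum_eq_zero fun j hj => by simpa using h hj
    exact Nat.one_le_iff_ne_zero.1 (r.one_le_blocksFun i) (by rw [← hrow i, h0])
  have hone : ∀ i, d i = 1 := by
    have := (Finset.sum_eq_sum_iff_of_le (s := Finset.univ) (f := fun _ => 1) (g := d)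
      fun i _ => hpos i).1 (by simp [hsum])
    exact fun i => (this i (Finset.mem_univ i)).symm
  choose f hf using fun i => Finset.card_eq_one.1 (hone i)
  have hmem : ∀ i j, A i j ≠ 0 ↔ j = f i := fun i j => by
    have := Finset.ext_iff.1 (hf i) j
    simpa using this
  have hval : ∀ i j, A i j = if j = f i then r.blocksFun i else 0 := fun i j => by
    split_ifs with h
    · rw [← hrow i, Finset.sum_eq_single j _ (by simp)]
      exact fun j' _ hj' => by_contra fun h' => hj' (((hmem i j').1 h').trans h.symm)
    · exact by_contra fun h' => h ((hmem i j).1 h')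
  have hsurj : Function.Surjective f := fun j => by
    by_contra! h
    have h0 : ∑ i, A i j = 0 := Finset.sum_eq_zero fun i _ =>
      by_contra fun h' => h i ((hmem i j).1 h').symm
    exact Nat.one_le_iff_ne_zero.1 (r.one_le_blocksFun j) (by rw [← hcol j, h0])
  have hinj : Function.Injective f := Finite.injective_iff_surjective.2 hsurj
  have hbij : Function.Bijective f := ⟨hinj, hsurj⟩
  refine ⟨Equiv.ofBijective f hbij, funext fun i => ?_, ?_⟩
  · rw [Function.comp_apply, Equiv.ofBijective_apply, ← hcol,
      Finset.sum_eq_single i _ (by simp), hval, if_pos rfl]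
    intro i' _ hi'
    rw [hval, if_neg fun h => hi' (hinj h).symm]
  · funext i j
    simp [monomialMatrix, hval]

theorem monomialMatrix_injective {n : ℕ} (r : Composition n) :
    Function.Injective (monomialMatrix r) := by
  intro ρ ρ' h
  ext i : 1
  by_contra hne
  have := congrFun (congrFun h i) (ρ i)
  simp only [monomialMatrix, if_true, if_neg hne] at this
  exact (Nat.one_le_iff_ne_zero.1 (r.one_le_blocksFun i)) this

theorem card_blocksFun_eq {n : ℕ} (r : Composition n) (a : ℕ) :
    Fintype.card {i // r.blocksFun i = a} = r.blocks.count a := by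
  rw [← r.ofFn_blocksFun, List.ofFn_eq_map, List.count, List.countP_map,
    List.countP_eq_length_filter, Fintype.card_subtype]
  have : ((fun x => x == a) ∘ r.blocksFun) = fun i => decide (r.blocksFun i = a) := by
    funext i
    simp [Function.comp, beq_eq_decide]
  rw [this]
  rfl

theorem card_NSet_self {n : ℕ} (r : Composition n) :
    Nat.card (NSet r r r) =
      ∏ i ∈ Finset.range (n + 1), (r.blocks.count i).factorial := by
  have hcard : Nat.card (NSet r r r) =
      Nat.card {ρ : Equiv.Perm (Fin r.length) // r.blocksFun ∘ ρ = r.blocksFun} := by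
    refine (Nat.card_congr (Equiv.ofBijective
      (fun ρ => ⟨monomialMatrix r ρ.1, monomialMatrix_mem_NSet r ρ.2⟩) ⟨?_, ?_⟩)).symm
    · exact fun ρ ρ' h => Subtype.ext (monomialMatrix_injective r (congrArg Subtype.val h))
    · rintro ⟨A, hA⟩
      obtain ⟨ρ, hρ, rfl⟩ := exists_eq_monomialMatrix r hA
      exact ⟨⟨ρ, hρ⟩, rfl⟩
  rw [hcard, Nat.card_eq_fintype_card, DomMulAct.stabilizer_card']
  simp only [card_blocksFun_eq]
  refine Finset.prod_subset (fun a ha => ?_) fun a _ ha => ?_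
  · obtain ⟨i, -, rfl⟩ := Finset.mem_image.1 ha
    exact Finset.mem_range.2 (Nat.lt_succ_of_le (r.blocksFun_le i))
  · rw [List.count_eq_zero_of_not_mem, Nat.factorial_zero]
    rw [← r.ofFn_blocksFun, List.mem_ofFn]
    simpa using ha

/-- In the expansion `(Ξ^r)² = Σ_s |N^s_{r,r}| Ξ^s` in the basis
`{Ξ^s}` of the descent algebra, the coefficient of `Ξ^r` is
`|N^r_{r,r}| = ∏_i m_i(r)!`. -/
theorem coeff_Xi_sq (n : ℕ) (r : Composition n) :
    Xi ℤ r * Xi ℤ r = ∑ s : Composition n, (Nat.card (NSet s r r) : ℤ) • Xi ℤ s ∧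
    Nat.card (NSet r r r) =
      ∏ i ∈ Finset.range (n + 1), (r.blocks.count i).factorial := by
  exact ⟨Xi_mul_Xi ℤ r r, card_NSet_self r⟩
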